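/- Let T be an n-tilting right R-module written as a direct limit T = lim A_i of a direct system of finitely presented modules. Assume: (a) the trace functor tr_T commutes with direct limits, so T ≅ lim tr_T(A_i); (b) T^{⊥₁} is closed under direct limits; (c) the tilting class T^⊥ is definable. Then T is pure projective, i.e. a direct summand of ⊕_i A_i. -/

import Mathlib

open CategoryTheory Limits DirectSum

universe u

noncomputable section

/-- `Ext^n_R(M, X) = 0`, via the `Ext` bifunctor on the abelian category of `R`-modules. -/
def ExtVanish (R : Type u) [Ring R] (n : ℕ) (M X : ModuleCat.{u} R) : Prop :=
  Subsingleton (((Ext ℤ (ModuleCat.{u} R) n).obj (Opposite.op M)).obj X)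

/-- A module `M` is pure projective if it is a direct summand of a direct sum of
finitely presented modules. -/
def IsPureProjective (R : Type u) [Ring R] (M : Type u) [AddCommGroup M] [Module R M] :
    Prop :=
  ∃ (ι : Type u) (F : ι → ModuleCat.{u} R),
    (∀ i, Module.FinitePresentation R (F i)) ∧
    ∃ (s : M →ₗ[R] (⨁ i, F i)) (r : (⨁ i, F i) →ₗ[R] M), r ∘ₗ s = LinearMap.id

/-- A submodule `Y ≤ X` is pure if every finitely presented module has the lifting
property with respect to the projection `X → X/Y` (equivalently, the inclusion stays
injective after tensoring by any module). -/
def IsPureSubmodule (R : Type u) [Ring R] (X : Type u) [AddCommGroup X] [Module R X]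
    (Y : Submodule R X) : Prop :=
  ∀ (F : Type u) [AddCommGroup F] [Module R F], Module.FinitePresentation R F →
    ∀ g : F →ₗ[R] (X ⧸ Y), ∃ h : F →ₗ[R] X, Y.mkQ ∘ₗ h = g

/-- The trace of `T` in `N`: the sum of the images of all homomorphisms `T → N`. -/
def traceSub (R : Type u) [Ring R] (T : Type u) [AddCommGroup T] [Module R T]
    (N : Type u) [AddCommGroup N] [Module R N] : Submodule R N :=
  ⨆ f : T →ₗ[R] N, LinearMap.range f

/-- `M` belongs to `Add T`: it is a direct summand of a direct sum of copies of `T`. -/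
def MemAddT (R : Type u) [Ring R] (T : Type u) [AddCommGroup T] [Module R T]
    (M : Type u) [AddCommGroup M] [Module R M] : Prop :=
  ∃ (κ : Type u) (s : M →ₗ[R] (κ →₀ T)) (p : (κ →₀ T) →ₗ[R] M), p ∘ₗ s = LinearMap.id

/-- `X` belongs to the class `T^⊥`, i.e. `Ext^i_R(T, X) = 0` for all `i ≥ 1`. -/
def InTPerp (R : Type u) [Ring R] (T : Type u) [AddCommGroup T] [Module R T]
    (X : ModuleCat.{u} R) : Prop :=
  ∀ i : ℕ, 1 ≤ i → ExtVanish R i (ModuleCat.of R T) X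

/-- A class of modules is closed under direct limits. -/
def ClosedUnderDirectLimits (R : Type u) [Ring R] (P : ModuleCat.{u} R → Prop) : Prop :=
  ∀ (ι : Type u) [Preorder ι] [IsDirected ι (· ≤ ·)] [Nonempty ι] [DecidableEq ι]
    (G : ι → ModuleCat.{u} R) (f : ∀ i j, i ≤ j → G i →ₗ[R] G j)
    [DirectedSystem (fun i => (G i : Type u)) (fun i j h => f i j h)],
    (∀ i, P (G i)) →
      P (ModuleCat.of R (Module.DirectLimit (fun i => (G i : Type u)) f))

/-- The trace functor of `T` commutes with direct limits: the trace of a direct limit is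
the supremum of the images of the traces of the components. -/
def TraceCommutesWithDirectLimits (R : Type u) [Ring R] (T : Type u) [AddCommGroup T]
    [Module R T] : Prop :=
  ∀ (ι : Type u) [Preorder ι] [IsDirected ι (· ≤ ·)] [Nonempty ι] [DecidableEq ι]
    (G : ι → ModuleCat.{u} R) (f : ∀ i j, i ≤ j → G i →ₗ[R] G j)
    [DirectedSystem (fun i => (G i : Type u)) (fun i j h => f i j h)],
    traceSub R T (Module.DirectLimit (fun i => (G i : Type u)) f) =
      ⨆ α, (traceSub R T (G α)).map (Module.DirectLimit.of R ι (fun i => (G i : Type u)) f α)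

/-- `T` is an `n`-tilting module: (T1) `pd T ≤ n` (expressed by the vanishing of
`Ext^i(T, -)` for `i > n`), (T2) `Ext^i(T, T^{(κ)}) = 0` for all `i ≥ 1` and all index
sets `κ`, (T3) `R` admits a finite exact coresolution by modules in `Add T`. -/
def IsNTilting (R : Type u) [Ring R] (n : ℕ) (T : Type u) [AddCommGroup T]
    [Module R T] : Prop :=
  (∀ (X : ModuleCat.{u} R) (i : ℕ), n < i → ExtVanish R i (ModuleCat.of R T) X) ∧
  (∀ (κ : Type u) (i : ℕ), 1 ≤ i →
    ExtVanish R i (ModuleCat.of R T) (ModuleCat.of R (κ →₀ T))) ∧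
  (∃ (U : ℕ → ModuleCat.{u} R) (ε : ModuleCat.of R R ⟶ U 0) (d : ∀ i, U i ⟶ U (i + 1)),
    (∀ i, MemAddT R T (U i)) ∧ Function.Injective ε ∧ Function.Exact ε (d 0) ∧
    (∀ i, Function.Exact (d i) (d (i + 1))) ∧ ∃ r, ∀ i, r < i → Subsingleton (U i))

lemma extVanish_one_iff {R : Type u} [Ring R] {M X : ModuleCat.{u} R} (P : ProjectiveResolution M) :
    ExtVanish R 1 M X ↔ ∀ g : P.complex.X 1 ⟶ X, P.complex.d 2 1 ≫ g = 0 →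
      ∃ h : P.complex.X 0 ⟶ X, P.complex.d 1 0 ≫ h = g := by
  rw [ExtVanish, ← ModuleCat.isZero_iff_subsingleton, (P.isoExt (R := ℤ) 1 X).isZero_iff,
    ← HomologicalComplex.exactAt_iff_isZero_homology,
    HomologicalComplex.exactAt_iff' _ 0 1 2 (by simp) (by simp), ShortComplex.moduleCat_exact_iff]
  rfl

lemma ExtVanish.exists_lift {R : Type u} [Ring R] {M : ModuleCat.{u} R}
    {S : ShortComplex (ModuleCat.{u} R)} (hS : S.ShortExact) (h : ExtVanish R 1 M S.X₁)
    (φ : M ⟶ S.X₃) : ∃ ψ : M ⟶ S.X₂, ψ ≫ S.g = φ := by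
  have := hS.mono_f
  have := hS.epi_g
  let P := projectiveResolution M
  have hex := P.exact₀
  let π : P.complex.X 0 ⟶ M := P.π.f 0
  have : Epi π := inferInstanceAs (Epi (P.π.f 0))
  have hdπ : P.complex.d 1 0 ≫ π = 0 := P.complex_d_comp_π_f_zero
  let a : P.complex.X 0 ⟶ S.X₂ := Projective.factorThru (π ≫ φ) S.g
  have ha : a ≫ S.g = π ≫ φ := Projective.factorThru_comp _ _
  have hda : (P.complex.d 1 0 ≫ a) ≫ S.g = 0 := by
    rw [Category.assoc, ha, reassoc_of% hdπ, zero_comp]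
  obtain ⟨b, hb⟩ := (extVanish_one_iff P).1 h (hS.exact.lift _ hda) (by
    rw [← cancel_mono S.f, Category.assoc, hS.exact.lift_f]; simp)
  have hab : P.complex.d 1 0 ≫ (a - b ≫ S.f) = 0 := by
    rw [Preadditive.comp_sub, reassoc_of% hb, hS.exact.lift_f, sub_self]
  obtain ⟨t, hd⟩ : ∃ t : M ⟶ S.X₂, π ≫ t = a - b ≫ S.f := ⟨hex.desc _ hab, hex.g_desc _ hab⟩
  refine ⟨t, ?_⟩
  rw [← cancel_epi π, reassoc_of% hd, Preadditive.sub_comp, Category.assoc, S.zero, ha]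
  simp

lemma extVanish_one_of_exists_lift {R : Type u} [Ring R] {M : ModuleCat.{u} R}
    {S : ShortComplex (ModuleCat.{u} R)} (hS : S.ShortExact) (h : ExtVanish R 1 M S.X₂)
    (hlift : ∀ φ : M ⟶ S.X₃, ∃ ψ : M ⟶ S.X₂, ψ ≫ S.g = φ) : ExtVanish R 1 M S.X₁ := by
  have := hS.mono_f
  let P := projectiveResolution M
  have hex := P.exact₀
  let π : P.complex.X 0 ⟶ M := P.π.f 0
  have hdπ : P.complex.d 1 0 ≫ π = 0 := P.complex_d_comp_π_f_zero
  refine (extVanish_one_iff P).2 fun g hg ↦ ?_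
  obtain ⟨b, hb⟩ := (extVanish_one_iff P).1 h (g ≫ S.f) (by rw [reassoc_of% hg, zero_comp])
  have hbg : P.complex.d 1 0 ≫ b ≫ S.g = 0 := by
    rw [reassoc_of% hb, S.zero, comp_zero]
  obtain ⟨t, hd⟩ : ∃ t : M ⟶ S.X₃, π ≫ t = b ≫ S.g := ⟨hex.desc _ hbg, hex.g_desc _ hbg⟩
  obtain ⟨ψ, hψ⟩ := hlift t
  have hbψ : (b - π ≫ ψ) ≫ S.g = 0 := by
    rw [Preadditive.sub_comp, Category.assoc, hψ, hd, sub_self]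
  refine ⟨hS.exact.lift _ hbψ, ?_⟩
  rw [← cancel_mono S.f, Category.assoc, hS.exact.lift_f, Preadditive.comp_sub, hb,
    reassoc_of% hdπ, zero_comp, sub_zero]

section Linear

variable {R : Type u} [Ring R] {M K B C : Type u} [AddCommGroup M] [Module R M]
  [AddCommGroup K] [Module R K] [AddCommGroup B] [Module R B] [AddCommGroup C] [Module R C]
  {i : K →ₗ[R] B} {p : B →ₗ[R] C}

lemma ExtVanish.exists_linearMap_lift
    (h : ExtVanish R 1 (ModuleCat.of R M) (ModuleCat.of R K)) (hi : Function.Injective i)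
    (hp : Function.Surjective p) (hex : Function.Exact i p) (φ : M →ₗ[R] C) :
    ∃ ψ : M →ₗ[R] B, p ∘ₗ ψ = φ := by
  let S := ModuleCat.shortComplexOfCompEqZero i p hex.linearMap_comp_eq_zero
  obtain ⟨ψ, hψ⟩ := ExtVanish.exists_lift (S := S)
    (ModuleCat.shortComplex_shortExact S hex hi hp) h (ModuleCat.ofHom φ)
  exact ⟨ψ.hom, congrArg ModuleCat.Hom.hom hψ⟩

lemma extVanish_one_of_exists_linearMap_lift
    (h : ExtVanish R 1 (ModuleCat.of R M) (ModuleCat.of R B)) (hi : Function.Injective i)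
    (hp : Function.Surjective p) (hex : Function.Exact i p)
    (hlift : ∀ φ : M →ₗ[R] C, ∃ ψ : M →ₗ[R] B, p ∘ₗ ψ = φ) :
    ExtVanish R 1 (ModuleCat.of R M) (ModuleCat.of R K) := by
  let S := ModuleCat.shortComplexOfCompEqZero i p hex.linearMap_comp_eq_zero
  refine extVanish_one_of_exists_lift (S := S)
    (ModuleCat.shortComplex_shortExact S hex hi hp) h fun φ ↦ ?_
  obtain ⟨ψ, hψ⟩ := hlift φ.hom
  exact ⟨ModuleCat.ofHom ψ, ModuleCat.hom_ext hψ⟩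

end Linear

section DirectLimit

open Module

variable {R : Type*} [Ring R] {ι : Type*} [Preorder ι] [IsDirected ι (· ≤ ·)] [Nonempty ι]
  [DecidableEq ι] {G : ι → Type*} [∀ i, AddCommGroup (G i)] [∀ i, Module R (G i)]
  {f : ∀ i j, i ≤ j → G i →ₗ[R] G j}

lemma Module.DirectLimit.exists_comp_of_eq_of_fin {n : ℕ}
    (φ : (Fin n → R) →ₗ[R] DirectLimit G f) :
    ∃ (i : ι) (ψ : (Fin n → R) →ₗ[R] G i), DirectLimit.of R ι G f i ∘ₗ ψ = φ := by
  choose k x hx using fun a : Fin n ↦ DirectLimit.exists_of (φ (Pi.basisFun R (Fin n) a))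
  obtain ⟨j, hj⟩ := Finite.exists_le k
  refine ⟨j, (Pi.basisFun R (Fin n)).constr ℕ fun a ↦ f (k a) j (hj a) (x a), ?_⟩
  refine (Pi.basisFun R (Fin n)).ext fun a ↦ ?_
  rw [LinearMap.comp_apply, Basis.constr_basis, DirectLimit.of_f, hx]

lemma Module.DirectLimit.exists_comp_eq_zero_of_fin
    [DirectedSystem G fun i j h ↦ f i j h] {n : ℕ} {i : ι} (ψ : (Fin n → R) →ₗ[R] G i)
    (hψ : DirectLimit.of R ι G f i ∘ₗ ψ = 0) :
    ∃ (j : ι) (h : i ≤ j), f i j h ∘ₗ ψ = 0 := by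
  choose k hk h0 using fun a : Fin n ↦
    DirectLimit.of.zero_exact (LinearMap.congr_fun hψ (Pi.basisFun R (Fin n) a))
  obtain ⟨l, hl⟩ := Finite.exists_le k
  obtain ⟨j, hij, hlj⟩ := exists_ge_ge i l
  refine ⟨j, hij, (Pi.basisFun R (Fin n)).ext fun a ↦ ?_⟩
  rw [LinearMap.comp_apply, LinearMap.zero_apply,
    ← DirectedSystem.map_map (fun i j h ↦ f i j h) (hk a) ((hl a).trans hlj), h0, map_zero]

lemma Module.FinitePresentation.exists_directLimit_of_comp_eq
    [DirectedSystem G fun i j h ↦ f i j h] {F : Type*} [AddCommGroup F] [Module R F]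
    [Module.FinitePresentation R F] (φ : F →ₗ[R] DirectLimit G f) :
    ∃ (i : ι) (ψ : F →ₗ[R] G i), DirectLimit.of R ι G f i ∘ₗ ψ = φ := by
  obtain ⟨n, m, q, g, hq, hex⟩ := Module.FinitePresentation.exists_fin' R F
  obtain ⟨i, ψ, hψ⟩ := DirectLimit.exists_comp_of_eq_of_fin (φ ∘ₗ q)
  obtain ⟨j, hij, hj⟩ := DirectLimit.exists_comp_eq_zero_of_fin (ψ ∘ₗ g) (by
    rw [← LinearMap.comp_assoc, hψ, LinearMap.comp_assoc, hex.linearMap_comp_eq_zero,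
      LinearMap.comp_zero])
  have hker : LinearMap.ker q ≤ LinearMap.ker (f i j hij ∘ₗ ψ) := by
    intro x hx
    obtain ⟨y, rfl⟩ := (hex x).1 hx
    exact LinearMap.congr_fun hj y
  refine ⟨j, (LinearMap.ker q).liftQ _ hker ∘ₗ
    (q.quotKerEquivOfSurjective hq).symm.toLinearMap, ?_⟩
  ext x
  obtain ⟨x, rfl⟩ := hq x
  have : (q.quotKerEquivOfSurjective hq).symm (q x) = (LinearMap.ker q).mkQ x := by
    rw [LinearEquiv.symm_apply_eq]; rfl
  simp only [LinearMap.comp_apply, LinearEquiv.coe_coe, this, Submodule.mkQ_apply,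
    Submodule.liftQ_apply, DirectLimit.of_f]
  exact LinearMap.congr_fun hψ x

variable {G₁ G₂ : ι → Type*} [∀ i, AddCommGroup (G₁ i)] [∀ i, Module R (G₁ i)]
  [∀ i, AddCommGroup (G₂ i)] [∀ i, Module R (G₂ i)]
  {f₁ : ∀ i j, i ≤ j → G₁ i →ₗ[R] G₁ j} {f₂ : ∀ i j, i ≤ j → G₂ i →ₗ[R] G₂ j}
  [DirectedSystem G₂ fun i j h ↦ f₂ i j h]

lemma Module.DirectLimit.map_injective {g : ∀ i, G i →ₗ[R] G₂ i}
    (hg : ∀ i j h, g j ∘ₗ f i j h = f₂ i j h ∘ₗ g i) (hinj : ∀ i, Function.Injective (g i)) :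
    Function.Injective (DirectLimit.map g hg) := by
  rw [injective_iff_map_eq_zero]
  intro z hz
  obtain ⟨i, x, rfl⟩ := DirectLimit.exists_of z
  rw [DirectLimit.map_apply_of] at hz
  obtain ⟨j, hij, h0⟩ := DirectLimit.of.zero_exact hz
  have hx : f i j hij x = 0 := hinj j (by
    rw [map_zero, ← h0]; exact LinearMap.congr_fun (hg i j hij) x)
  rw [← DirectLimit.of_f (hij := hij), hx, map_zero]

lemma Module.DirectLimit.map_exact {g : ∀ i, G i →ₗ[R] G₁ i} {g' : ∀ i, G₁ i →ₗ[R] G₂ i}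
    (hg : ∀ i j h, g j ∘ₗ f i j h = f₁ i j h ∘ₗ g i)
    (hg' : ∀ i j h, g' j ∘ₗ f₁ i j h = f₂ i j h ∘ₗ g' i)
    (hex : ∀ i, Function.Exact (g i) (g' i)) :
    Function.Exact (DirectLimit.map g hg) (DirectLimit.map g' hg') := by
  intro z
  constructor
  · intro hz
    obtain ⟨i, x, rfl⟩ := DirectLimit.exists_of z
    rw [DirectLimit.map_apply_of] at hz
    obtain ⟨j, hij, h0⟩ := DirectLimit.of.zero_exact hz
    obtain ⟨y, hy⟩ := (hex j (f₁ i j hij x)).1 (by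
      rw [← h0]; exact LinearMap.congr_fun (hg' i j hij) x)
    exact ⟨DirectLimit.of R ι G f j y, by rw [DirectLimit.map_apply_of, hy, DirectLimit.of_f]⟩
  · rintro ⟨w, rfl⟩
    obtain ⟨i, y, rfl⟩ := DirectLimit.exists_of w
    rw [DirectLimit.map_apply_of, DirectLimit.map_apply_of, (hex i).apply_apply_eq_zero, map_zero]

end DirectLimit

lemma isPureSubmodule_ker_of_exists_section {R : Type u} [Ring R] {ι : Type u} [Preorder ι]
    [IsDirected ι (· ≤ ·)] [Nonempty ι] [DecidableEq ι] {G : ι → Type u}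
    [∀ i, AddCommGroup (G i)] [∀ i, Module R (G i)] {f : ∀ i j, i ≤ j → G i →ₗ[R] G j}
    [DirectedSystem G fun i j h ↦ f i j h] {X : Type u} [AddCommGroup X] [Module R X]
    (p : X →ₗ[R] Module.DirectLimit G f)
    (hp : ∀ i, ∃ s : G i →ₗ[R] X, p ∘ₗ s = Module.DirectLimit.of R ι G f i) :
    IsPureSubmodule R X (LinearMap.ker p) := by
  intro F _ _ _ g
  let q := (LinearMap.ker p).liftQ p le_rfl
  have hq : Function.Injective q := LinearMap.ker_eq_bot.1 (Submodule.ker_liftQ_eq_bot' _ _ rfl)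
  obtain ⟨i, ψ, hψ⟩ := Module.FinitePresentation.exists_directLimit_of_comp_eq (q ∘ₗ g)
  obtain ⟨s, hs⟩ := hp i
  refine ⟨s ∘ₗ ψ, LinearMap.ext fun x ↦ hq ?_⟩
  have h₁ : p (s (ψ x)) = Module.DirectLimit.of R ι G f i (ψ x) := LinearMap.congr_fun hs (ψ x)
  exact h₁.trans (LinearMap.congr_fun hψ x)

section Evaluation

variable (R : Type u) [Ring R] (T : Type u) [AddCommGroup T] [Module R T]

/-- The canonical map `T^{(Hom(T, N))} → N`, whose image is the trace of `T` in `N`. -/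
def traceEval (N : Type u) [AddCommGroup N] [Module R N] : ((T →ₗ[R] N) →₀ T) →ₗ[R] N :=
  Finsupp.lsum ℕ fun g ↦ g

variable {R T} {N N' N'' : Type u} [AddCommGroup N] [Module R N] [AddCommGroup N'] [Module R N']
  [AddCommGroup N''] [Module R N'']

@[simp]
lemma traceEval_single (g : T →ₗ[R] N) (t : T) : traceEval R T N (Finsupp.single g t) = g t := by
  simp [traceEval]

variable (R T N) in
lemma traceSub_le_range_traceEval : traceSub R T N ≤ LinearMap.range (traceEval R T N) := by
  refine iSup_le fun g ↦ ?_
  rintro _ ⟨t, rfl⟩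
  exact ⟨Finsupp.single g t, traceEval_single g t⟩

variable (T) in
/-- The map `T^{(Hom(T, N))} → T^{(Hom(T, N'))}` induced by a linear map `N → N'`. -/
def traceEvalMap (g : N →ₗ[R] N') : ((T →ₗ[R] N) →₀ T) →ₗ[R] ((T →ₗ[R] N') →₀ T) :=
  Finsupp.lmapDomain T R fun h ↦ g ∘ₗ h

@[simp]
lemma traceEvalMap_single (g : N →ₗ[R] N') (h : T →ₗ[R] N) (t : T) :
    traceEvalMap T g (Finsupp.single h t) = Finsupp.single (g ∘ₗ h) t := by
  simp [traceEvalMap]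

lemma traceEval_comp_traceEvalMap (g : N →ₗ[R] N') :
    traceEval R T N' ∘ₗ traceEvalMap T g = g ∘ₗ traceEval R T N :=
  Finsupp.lhom_ext fun h t ↦ by simp

lemma traceEvalMap_id : traceEvalMap T (LinearMap.id : N →ₗ[R] N) = LinearMap.id :=
  Finsupp.lhom_ext fun h t ↦ by simp

lemma traceEvalMap_comp (g' : N' →ₗ[R] N'') (g : N →ₗ[R] N') :
    traceEvalMap T g' ∘ₗ traceEvalMap T g = traceEvalMap T (g' ∘ₗ g) :=
  Finsupp.lhom_ext fun h t ↦ by simp [LinearMap.comp_assoc]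

variable (N) in
lemma extVanish_one_ker_traceEval
    (hT : ExtVanish R 1 (ModuleCat.of R T) (ModuleCat.of R ((T →ₗ[R] N) →₀ T))) :
    ExtVanish R 1 (ModuleCat.of R T) (ModuleCat.of R (LinearMap.ker (traceEval R T N))) := by
  refine extVanish_one_of_exists_linearMap_lift (p := (traceEval R T N).rangeRestrict) hT
    (LinearMap.ker (traceEval R T N)).injective_subtype
    (traceEval R T N).surjective_rangeRestrict ?_ fun φ ↦ ?_
  · rw [LinearMap.exact_iff, LinearMap.ker_rangeRestrict, Submodule.range_subtype]
  · refine ⟨Finsupp.lsingle ((LinearMap.range (traceEval R T N)).subtype ∘ₗ φ), ?_⟩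
    ext t
    simp

variable {ι : Type u} [Preorder ι] {A : ι → Type u} [∀ i, AddCommGroup (A i)]
  [∀ i, Module R (A i)] (f : ∀ i j, i ≤ j → A i →ₗ[R] A j)

lemma directedSystem_traceEvalMap [hf : DirectedSystem A fun i j h ↦ f i j h] :
    DirectedSystem (fun i ↦ (T →ₗ[R] A i) →₀ T) fun i j h ↦ traceEvalMap T (f i j h) where
  map_self i x := by
    have : f i i le_rfl = LinearMap.id := LinearMap.ext fun y ↦ hf.map_self y
    rw [this, traceEvalMap_id, LinearMap.id_apply]
  map_map _ _ _ hij hjk x := by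
    have : f _ _ hjk ∘ₗ f _ _ hij = f _ _ (hij.trans hjk) :=
      LinearMap.ext fun y ↦ hf.map_map hij hjk y
    rw [← this, ← traceEvalMap_comp, LinearMap.comp_apply]

variable (T) in
/-- The maps induced by a direct system on the kernels of the evaluation maps `traceEval`. -/
def kerTraceEvalMap (i j : ι) (h : i ≤ j) :
    LinearMap.ker (traceEval R T (A i)) →ₗ[R] LinearMap.ker (traceEval R T (A j)) :=
  (traceEvalMap T (f i j h)).restrict fun x hx ↦ by
    rw [LinearMap.mem_ker, ← LinearMap.comp_apply, traceEval_comp_traceEvalMap,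
      LinearMap.comp_apply, LinearMap.mem_ker.1 hx, map_zero]

lemma directedSystem_kerTraceEvalMap [hf : DirectedSystem A fun i j h ↦ f i j h] :
    DirectedSystem (fun i ↦ LinearMap.ker (traceEval R T (A i)))
      fun i j h ↦ kerTraceEvalMap T f i j h where
  map_self _ x := Subtype.ext ((directedSystem_traceEvalMap (T := T) f).map_self x.1)
  map_map _ _ _ hij hjk x :=
    Subtype.ext ((directedSystem_traceEvalMap (T := T) f).map_map hij hjk x.1)

end Evaluation

/-- Let `T` be an `n`-tilting module written as a direct limit `T = lim A_α` of a direct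
system of finitely presented modules. If the trace functor `tr_T` commutes with direct
limits, `T^{⊥₁}` is closed under direct limits, and the tilting class `T^⊥` is definable
(closed under products, direct limits and pure submodules), then `T` is pure projective:
it is a direct summand of `⊕_α A_α`. -/
theorem stmt8 (R : Type u) [Ring R] (n : ℕ) (T : Type u) [AddCommGroup T] [Module R T]
    (hT : IsNTilting R n T)
    (ι : Type u) [Preorder ι] [IsDirected ι (· ≤ ·)] [Nonempty ι] [DecidableEq ι]
    (A : ι → Type u) [∀ α, AddCommGroup (A α)] [∀ α, Module R (A α)]
    (hfp : ∀ α, Module.FinitePresentation R (A α))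
    (f : ∀ α β, α ≤ β → A α →ₗ[R] A β) [DirectedSystem A (fun α β h => f α β h)]
    (e : Module.DirectLimit A f ≃ₗ[R] T)
    -- (a) the trace functor commutes with direct limits:
    (htr : TraceCommutesWithDirectLimits R T)
    -- (b) `T^{⊥₁}` is closed under direct limits:
    (h1 : ClosedUnderDirectLimits R
      (fun X => ExtVanish R 1 (ModuleCat.of R T) X))
    -- (c) the tilting class `T^⊥` is definable:
    (hprod : ∀ (κ : Type u) (G : κ → ModuleCat.{u} R),
      (∀ k, InTPerp R T (G k)) → InTPerp R T (ModuleCat.of R (∀ k, G k)))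
    (hdlim : ClosedUnderDirectLimits R (fun X => InTPerp R T X))
    (hpure : ∀ (X : Type u) [AddCommGroup X] [Module R X] (Y : Submodule R X),
      IsPureSubmodule R X Y → InTPerp R T (ModuleCat.of R X) →
        InTPerp R T (ModuleCat.of R Y)) :
    ∃ (s : T →ₗ[R] (⨁ α, A α)) (r : (⨁ α, A α) →ₗ[R] T), r ∘ₗ s = LinearMap.id := by
  have hsys := directedSystem_traceEvalMap (T := T) f
  have hksys := directedSystem_kerTraceEvalMap (T := T) f
  -- the exact sequence `0 → lim K_α → lim T^{(Hom(T, A_α))} → lim A_α → 0`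
  let π := Module.DirectLimit.map (fun α ↦ traceEval R T (A α))
    fun α β h ↦ traceEval_comp_traceEvalMap (T := T) (f α β h)
  let k := Module.DirectLimit.map (f := kerTraceEvalMap T f)
    (f' := fun α β h ↦ traceEvalMap T (f α β h))
    (fun α ↦ (LinearMap.ker (traceEval R T (A α))).subtype) fun _ _ _ ↦ rfl
  have hk : Function.Injective k :=
    Module.DirectLimit.map_injective _ fun α ↦ Submodule.injective_subtype _
  have hkπ : Function.Exact k π := Module.DirectLimit.map_exact _ _ fun α ↦ by
    rw [LinearMap.exact_iff, Submodule.range_subtype]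
  have hπ_of (α : ι) (x : (T →ₗ[R] A α) →₀ T) :
      π (Module.DirectLimit.of R ι _ _ α x) =
        Module.DirectLimit.of R ι A f α (traceEval R T (A α) x) :=
    Module.DirectLimit.map_apply_of (fun α ↦ traceEval R T (A α)) _ x
  have hπ : Function.Surjective π := by
    have htrace := htr ι (fun α ↦ ModuleCat.of R (A α)) f
    rw [← LinearMap.range_eq_top, eq_top_iff]
    calc ⊤ ≤ traceSub R T (Module.DirectLimit A f) :=
          (LinearMap.range_eq_top.2 e.symm.surjective).ge.trans
            (le_iSup (fun g : T →ₗ[R] Module.DirectLimit A f ↦ LinearMap.range g)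
              e.symm.toLinearMap)
      _ ≤ _ := htrace.le
      _ ≤ LinearMap.range π := iSup_le fun α ↦ by
          refine (Submodule.map_mono (traceSub_le_range_traceEval R T (A α))).trans ?_
          rintro _ ⟨_, ⟨x, rfl⟩, rfl⟩
          exact ⟨_, hπ_of α x⟩
  have hK : ExtVanish R 1 (ModuleCat.of R T)
      (ModuleCat.of R (Module.DirectLimit _ (kerTraceEvalMap T f))) :=
    h1 ι (fun α ↦ ModuleCat.of R (LinearMap.ker (traceEval R T (A α)))) (kerTraceEvalMap T f)
      fun α ↦ extVanish_one_ker_traceEval (A α) (hT.2.1 _ 1 le_rfl)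
  obtain ⟨σ, hσ⟩ := hK.exists_linearMap_lift hk hπ hkπ e.symm.toLinearMap
  -- the canonical pure epimorphism onto `lim T^{(Hom(T, A_α))}`
  let p : ((Σ α, T →ₗ[R] A α) →₀ T) →ₗ[R]
      Module.DirectLimit _ fun α β h ↦ traceEvalMap T (f α β h) :=
    Finsupp.lsum ℕ fun x ↦ Module.DirectLimit.of R ι _ _ x.1 ∘ₗ Finsupp.lsingle x.2
  have hsec : ∀ α, ∃ s, p ∘ₗ s = Module.DirectLimit.of R ι _ _ α := fun α ↦
    ⟨Finsupp.lmapDomain T R fun g ↦ ⟨α, g⟩, Finsupp.lhom_ext fun g t ↦ by simp [p]⟩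
  have hp : Function.Surjective p := fun z ↦ by
    obtain ⟨α, x, rfl⟩ := Module.DirectLimit.exists_of z
    obtain ⟨s, hs⟩ := hsec α
    exact ⟨s x, LinearMap.congr_fun hs x⟩
  have hL := hpure _ _ (isPureSubmodule_ker_of_exists_section p hsec) (hT.2.1 _) 1 le_rfl
  obtain ⟨τ, hτ⟩ := ExtVanish.exists_linearMap_lift hL (Submodule.injective_subtype _) hp
    (by rw [LinearMap.exact_iff, Submodule.range_subtype]) σ
  let q : ((Σ α, T →ₗ[R] A α) →₀ T) →ₗ[R] ⨁ α, A α :=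
    Finsupp.lsum ℕ fun x ↦ DirectSum.lof R ι A x.1 ∘ₗ x.2
  let r := DirectSum.toModule R ι _ fun α ↦ Module.DirectLimit.of R ι A f α
  have hrq : r ∘ₗ q = π ∘ₗ p := Finsupp.lhom_ext fun x t ↦ by
    simp [r, q, π, p]
  refine ⟨q ∘ₗ τ, e.toLinearMap ∘ₗ r, LinearMap.ext fun t ↦ ?_⟩
  have h := LinearMap.congr_fun hrq (τ t)
  simp only [LinearMap.comp_apply] at h ⊢
  rw [h, ← LinearMap.comp_apply p τ, hτ, ← LinearMap.comp_apply π σ, hσ]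
  simp

end
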